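/- arXiv:1609.06090 — 2 statements merged into one kernel-verified Lean document; each statement's English description precedes it below -/
import Mathlib

section
/- For every complex s with Re(s) > r, one has ζ_a(s) = (1/((r−1)! D^s)) ∑_{m=0}^{r−1} ∑_{v=1}^{D} γ_{mv} · ζ(s−m, v/D), where γ_{mv} := ∑_{(j_1,…,j_r): 0 ≤ j_i ≤ D/a_i − 1 for all i, a_1j_1+⋯+a_rj_r ≡ v (mod D)} ∑_{k=m}^{r−1} [r,k] (−1)^{k−m} C(k,m) ((a_1j_1+⋯+a_rj_r)/D)^{k−m}. -/
/-- Hurwitz zeta function as a series: `ζ(s,w) = ∑_{n≥0} (n+w)^{-s}`. -/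
noncomputable def hurwitzZetaSeries (s w : ℂ) : ℂ := ∑' n : ℕ, ((n : ℂ) + w) ^ (-s)

/-- The restricted partition function: the number of tuples `(x₁,…,x_r)` of nonnegative
integers with `a₁x₁+⋯+a_rx_r = n`. -/
noncomputable def restrictedPartition (r : ℕ) (a : Fin r → ℕ) (n : ℕ) : ℕ :=
  Nat.card {x : Fin r → ℕ // ∑ i, a i * x i = n}

theorem card_sum_eq_mul_factorial {r : ℕ} (hr : 1 ≤ r) (N : ℕ) :
    ((Nat.card {q : Fin r → ℕ // ∑ i, q i = N} : ℕ) : ℂ) * (Nat.factorial (r - 1) : ℂ) =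
      ∏ i ∈ Finset.range (r - 1), ((N : ℂ) + (i + 1 : ℕ)) := by
  have h : Nat.card {q : Fin r → ℕ // ∑ i, q i = N} = (N + (r - 1)).choose (r - 1) := by
    rw [← Nat.card_congr (Sym.equivNatSumOfFintype (Fin r) N), Nat.card_eq_fintype_card,
      Sym.card_sym_eq_choose, Fintype.card_fin]
    obtain ⟨k, rfl⟩ := Nat.exists_eq_add_of_le' hr
    rw [← Nat.choose_symm_of_eq_add (a := k) (b := N)] <;> congr 1 <;> omega
  rw [h, mul_comm, ← Nat.cast_mul, ← Nat.ascFactorial_eq_factorial_mul_choose,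
    Nat.ascFactorial_eq_prod_range]
  push_cast
  exact Finset.prod_congr rfl fun i _ => by ring

theorem card_add_mul_sum_eq_mul_factorial {r : ℕ} (hr : 1 ≤ r) {D : ℕ} (hD : 0 < D) {S : ℕ}
    (hS : S < r * D) (n : ℕ) :
    ((Nat.card {q : Fin r → ℕ // S + D * ∑ i, q i = n} : ℕ) : ℂ) * (Nat.factorial (r - 1) : ℂ) =
      if S % D = n % D then
        ∏ i ∈ Finset.range (r - 1), (((n : ℂ) - S) / D + (i + 1 : ℕ)) else 0 := by
  have hD' : (D : ℂ) ≠ 0 := by exact_mod_cast hD.ne'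
  split_ifs with hmod
  · rcases le_or_gt S n with hle | hlt
    · obtain ⟨N, hN⟩ := (Nat.modEq_iff_dvd' hle).1 hmod
      obtain rfl : n = S + D * N := by omega
      have e : ∀ q : Fin r → ℕ, S + D * ∑ i, q i = S + D * N ↔ ∑ i, q i = N := fun q => by
        rw [Nat.add_left_cancel_iff, Nat.mul_right_inj hD.ne']
      rw [Nat.card_congr (Equiv.subtypeEquivRight e), card_sum_eq_mul_factorial hr]
      have : (((S + D * N : ℕ) : ℂ) - S) / D = N := by push_cast; field_simp; ring
      rw [this]
    · obtain ⟨N, hN⟩ := (Nat.modEq_iff_dvd' hlt.le).1 hmod.symm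
      obtain rfl : S = n + D * N := by omega
      have : IsEmpty {q : Fin r → ℕ // n + D * N + D * ∑ i, q i = n} := ⟨fun q => by
        have := q.2; omega⟩
      have hN0 : N ≠ 0 := by rintro rfl; simp at hlt
      have hNr : N < r := by
        by_contra! h
        have := Nat.mul_le_mul_left D h
        rw [mul_comm D r] at this
        omega
      rw [Nat.card_of_isEmpty, Nat.cast_zero, zero_mul, eq_comm]
      refine Finset.prod_eq_zero (i := N - 1) (Finset.mem_range.2 (by omega)) ?_
      rw [Nat.sub_add_cancel (Nat.pos_of_ne_zero hN0)]
      push_cast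
      field_simp
      ring
  · have : IsEmpty {q : Fin r → ℕ // S + D * ∑ i, q i = n} := ⟨fun q => hmod (by
      rw [← q.2, Nat.add_mul_mod_self_left])⟩
    simp

/-- Dividing each `x i` by `D / a i` splits a solution of `∑ a i * x i = n` into its remainders
and its quotients. -/
theorem restrictedPartition_eq_sum_card {r : ℕ} {a : Fin r → ℕ} (ha : ∀ i, 0 < a i) {D : ℕ}
    (hD : 0 < D) (hdvd : ∀ i, a i ∣ D) (n : ℕ) :
    restrictedPartition r a n = ∑ j : ∀ i : Fin r, Fin (D / a i),
      Nat.card {q : Fin r → ℕ // (∑ i, a i * (j i : ℕ)) + D * ∑ i, q i = n} := by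
  have hpos : ∀ i, 0 < D / a i := fun i => Nat.div_pos (Nat.le_of_dvd hD (hdvd i)) (ha i)
  have key : ∀ (j : ∀ i : Fin r, Fin (D / a i)) (q : Fin r → ℕ),
      ∑ i, a i * ((j i : ℕ) + D / a i * q i) = (∑ i, a i * (j i : ℕ)) + D * ∑ i, q i := by
    intro j q
    rw [Finset.mul_sum, ← Finset.sum_add_distrib]
    refine Finset.sum_congr rfl fun i _ => ?_
    rw [mul_add, ← mul_assoc, Nat.mul_div_cancel' (hdvd i)]
  let e : {x : Fin r → ℕ // ∑ i, a i * x i = n} ≃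
      Σ j : ∀ i : Fin r, Fin (D / a i),
        {q : Fin r → ℕ // (∑ i, a i * (j i : ℕ)) + D * ∑ i, q i = n} :=
    { toFun := fun x => ⟨fun i => ⟨x.1 i % (D / a i), Nat.mod_lt _ (hpos i)⟩,
        fun i => x.1 i / (D / a i), by
          rw [← key]
          simp only [Nat.mod_add_div]
          exact x.2⟩
      invFun := fun p => ⟨fun i => (p.1 i : ℕ) + D / a i * p.2.1 i, by rw [key]; exact p.2.2⟩
      left_inv := fun x => by
        apply Subtype.ext
        funext i
        exact Nat.mod_add_div _ _
      right_inv := by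
        rintro ⟨j, q, hq⟩
        have h1 : (fun i => (⟨((j i : ℕ) + D / a i * q i) % (D / a i), Nat.mod_lt _ (hpos i)⟩ :
            Fin (D / a i))) = j := by
          funext i
          apply Fin.ext
          simp [Nat.mod_eq_of_lt (j i).2]
        have h2 : (fun i => ((j i : ℕ) + D / a i * q i) / (D / a i)) = q := by
          funext i
          rw [Nat.add_mul_div_left _ _ (hpos i), Nat.div_eq_of_lt (j i).2, zero_add]
        refine Sigma.subtype_ext h1 h2 }
  have hfin : ∀ j : ∀ i : Fin r, Fin (D / a i),
      Finite {q : Fin r → ℕ // (∑ i, a i * (j i : ℕ)) + D * ∑ i, q i = n} := fun j =>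
    Finite.of_injective
      (fun q i => (⟨q.1 i, by
        have h1 := q.2
        have h2 : q.1 i ≤ ∑ i, q.1 i :=
          Finset.single_le_sum (f := q.1) (fun _ _ => Nat.zero_le _) (Finset.mem_univ i)
        have h3 := Nat.le_mul_of_pos_left (∑ i, q.1 i) hD
        omega⟩ : Fin (n + 1)))
      (fun q q' h => Subtype.ext (funext fun i => by simpa using congrFun h i))
  rw [restrictedPartition, Nat.card_congr e, Nat.card_sigma]

theorem sum_mul_sub_pow_eq {r : ℕ} (hr : 1 ≤ r) (c : ℕ → ℕ) (y z : ℂ) :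
    ∑ k ∈ Finset.range r, (c k : ℂ) * (y - z) ^ k =
      ∑ m ∈ Finset.range r, (∑ k ∈ Finset.Icc m (r - 1),
        (c k : ℂ) * (-1) ^ (k - m) * (k.choose m : ℂ) * z ^ (k - m)) * y ^ m := by
  simp_rw [sub_eq_add_neg, add_pow, Finset.mul_sum, Finset.sum_mul]
  rw [Finset.sum_comm' (t' := Finset.range r) (s' := fun m => Finset.Icc m (r - 1))]
  · refine Finset.sum_congr rfl fun m _ => Finset.sum_congr rfl fun k _ => ?_
    rw [neg_pow z]
    ring
  · intro k m
    simp only [Finset.mem_range, Finset.mem_Icc]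
    omega

/-- The restricted partition function is a quasi-polynomial of period `D`. -/
theorem restrictedPartition_mul_factorial {r : ℕ} (hr : 1 ≤ r) {a : Fin r → ℕ}
    (ha : ∀ i, 0 < a i) {D : ℕ} (hD : 0 < D) (hdvd : ∀ i, a i ∣ D) {c : ℕ → ℕ}
    (hc : ∀ x : ℂ, ∏ i ∈ Finset.range (r - 1), (x + (i + 1 : ℕ)) =
      ∑ k ∈ Finset.range r, (c k : ℂ) * x ^ k) (n : ℕ) :
    (restrictedPartition r a n : ℂ) * (Nat.factorial (r - 1) : ℂ) =
      ∑ m ∈ Finset.range r,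
        (∑ j ∈ Finset.univ.filter
            (fun j : ∀ i : Fin r, Fin (D / a i) => (∑ i, a i * (j i : ℕ)) % D = n % D),
          ∑ k ∈ Finset.Icc m (r - 1),
            (c k : ℂ) * (-1) ^ (k - m) * (k.choose m : ℂ) *
              (((∑ i, a i * (j i : ℕ) : ℕ) : ℂ) / (D : ℂ)) ^ (k - m)) * ((n : ℂ) / D) ^ m := by
  have hS : ∀ j : ∀ i : Fin r, Fin (D / a i), ∑ i, a i * (j i : ℕ) < r * D := by
    intro j
    have : Nonempty (Fin r) := ⟨⟨0, hr⟩⟩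
    have h : ∑ i, a i * (j i : ℕ) < ∑ _i : Fin r, D := by
      refine Finset.sum_lt_sum_of_nonempty Finset.univ_nonempty fun i _ => ?_
      calc a i * (j i : ℕ) < a i * (D / a i) := Nat.mul_lt_mul_of_pos_left (j i).2 (ha i)
        _ = D := Nat.mul_div_cancel' (hdvd i)
    simpa using h
  rw [restrictedPartition_eq_sum_card ha hD hdvd, Nat.cast_sum, Finset.sum_mul]
  simp_rw [card_add_mul_sum_eq_mul_factorial hr hD (hS _), hc, sub_div, sum_mul_sub_pow_eq hr]
  rw [← Finset.sum_filter, Finset.sum_comm]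
  simp_rw [Finset.sum_mul]

theorem hasSum_hurwitzZetaSeries {s : ℂ} (hs : 1 < s.re) {w : ℝ} (hw : 0 < w) :
    HasSum (fun n : ℕ => ((n : ℂ) + (w : ℂ)) ^ (-s)) (hurwitzZetaSeries s w) := by
  refine Summable.hasSum (Summable.of_norm ?_)
  refine ((Real.summable_one_div_nat_add_rpow w s.re).2 hs).congr fun n => ?_
  have h : 0 < (n : ℝ) + w := by positivity
  have := Complex.norm_cpow_eq_rpow_re_of_pos h (-s)
  push_cast at this
  rw [this, abs_of_pos h, Complex.neg_re, Real.rpow_neg h.le, one_div]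

theorem HasSum.of_residues {F : ℕ → ℂ} {A : ℕ → ℂ} {D : ℕ} (hD : 0 < D)
    (h : ∀ t < D, HasSum (fun q => F (D * q + t)) (A t)) :
    HasSum F (∑ t ∈ Finset.range D, A t) := by
  have key : ∀ t ∈ Finset.range D, HasSum (fun n => if n % D = t then F n else 0) (A t) := by
    intro t ht
    have ht := Finset.mem_range.1 ht
    have hinj : Function.Injective fun q : ℕ => D * q + t := fun q q' hq => by
      simpa [hD.ne'] using hq
    rw [← hinj.hasSum_iff]
    · convert h t ht using 2 with q
      simp [Nat.mod_eq_of_lt ht]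
    · intro n hn
      refine if_neg fun hmod => hn ⟨n / D, ?_⟩
      simp only [← hmod, Nat.div_add_mod]
  convert hasSum_sum key using 2 with n
  simp [Nat.mod_lt n hD]

/-- Lemma 1.4: `ζ_a(s) = (1/((r−1)! Dˢ)) ∑_{m=0}^{r−1} ∑_{v=1}^{D} γ_{mv} ζ(s−m, v/D)`. -/
theorem dirichlet_series_gamma_decomposition
    (r : ℕ) (hr : 1 ≤ r) (a : Fin r → ℕ) (ha : ∀ i, 0 < a i)
    (D : ℕ) (hD : 0 < D) (hdvd : ∀ i, a i ∣ D)
    (c : ℕ → ℕ)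
    (hc : ∀ x : ℂ, ∏ i ∈ Finset.range (r - 1), (x + (i + 1 : ℕ)) =
      ∑ k ∈ Finset.range r, (c k : ℂ) * x ^ k)
    (γ : ℕ → ℕ → ℂ)
    (hγ : ∀ m, ∀ v, γ m v =
      ∑ j ∈ Finset.univ.filter
          (fun j : ∀ i : Fin r, Fin (D / a i) => (∑ i, a i * (j i : ℕ)) % D = v % D),
        ∑ k ∈ Finset.Icc m (r - 1),
          (c k : ℂ) * (-1) ^ (k - m) * (k.choose m : ℂ) *
            (((∑ i, a i * (j i : ℕ) : ℕ) : ℂ) / (D : ℂ)) ^ (k - m))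
    (s : ℂ) (hs : (r : ℝ) < s.re) :
    (∑' n : ℕ, (restrictedPartition r a (n + 1) : ℂ) * (((n + 1 : ℕ)) : ℂ) ^ (-s)) =
      1 / ((Nat.factorial (r - 1) : ℂ) * (D : ℂ) ^ s) *
        ∑ m ∈ Finset.range r, ∑ v ∈ Finset.Icc 1 D,
          γ m v * hurwitzZetaSeries (s - (m : ℂ)) ((v : ℂ) / (D : ℂ)) := by
  have hD' : (D : ℂ) ≠ 0 := by exact_mod_cast hD.ne'
  have hfac : (Nat.factorial (r - 1) : ℂ) ≠ 0 := by exact_mod_cast Nat.factorial_ne_zero _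
  have hDs : (D : ℂ) ^ s ≠ 0 := by simp [Complex.cpow_eq_zero_iff, hD']
  have hterm : ∀ t q : ℕ,
      (restrictedPartition r a (D * q + t + 1) : ℂ) * ((D * q + t + 1 : ℕ) : ℂ) ^ (-s) =
        1 / ((Nat.factorial (r - 1) : ℂ) * (D : ℂ) ^ s) * ∑ m ∈ Finset.range r,
          γ m (t + 1) * ((q : ℂ) + (((t + 1 : ℕ) / D : ℝ) : ℂ)) ^ (-(s - m)) := by
    intro t q
    have hp := restrictedPartition_mul_factorial hr ha hD hdvd hc (D * q + t + 1)
    have hmod : (D * q + t + 1) % D = (t + 1) % D := by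
      rw [add_assoc, Nat.mul_add_mod]
    rw [hmod] at hp
    simp_rw [← hγ] at hp
    set y : ℝ := q + ((t + 1 : ℕ) / D : ℝ) with hy
    have hy0 : 0 < y := by positivity
    have hyc : (y : ℂ) ≠ 0 := by exact_mod_cast hy0.ne'
    have hn : ((D * q + t + 1 : ℕ) : ℂ) = (D : ℝ) * (y : ℂ) := by
      rw [hy]; push_cast; field_simp; ring
    have hdiv : ((D * q + t + 1 : ℕ) : ℂ) / D = y := by
      rw [hn, Complex.ofReal_natCast]; field_simp
    have hyq : (q : ℂ) + (((t + 1 : ℕ) / D : ℝ) : ℂ) = y := by rw [hy]; push_cast; rfl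
    rw [hdiv] at hp
    rw [hyq, hn, Complex.mul_cpow_ofReal_nonneg (Nat.cast_nonneg D) hy0.le, Complex.cpow_neg,
      Complex.ofReal_natCast, eq_div_of_mul_eq hfac hp]
    have hpow : ∀ m : ℕ, (y : ℂ) ^ (-(s - m)) = (y : ℂ) ^ m * (y : ℂ) ^ (-s) := fun m => by
      rw [neg_sub, sub_eq_add_neg, Complex.cpow_add _ _ hyc, Complex.cpow_natCast]
    simp_rw [hpow, ← mul_assoc, ← Finset.sum_mul]
    field_simp
  have hsum := HasSum.of_residues hD (F := fun n =>
      (restrictedPartition r a (n + 1) : ℂ) * (((n + 1 : ℕ)) : ℂ) ^ (-s))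
    (A := fun t => 1 / ((Nat.factorial (r - 1) : ℂ) * (D : ℂ) ^ s) * ∑ m ∈ Finset.range r,
      γ m (t + 1) * hurwitzZetaSeries (s - m) (((t + 1 : ℕ) / D : ℝ) : ℂ)) (by
    intro t _
    simp only [hterm]
    refine HasSum.mul_left _ (hasSum_sum fun m hm => HasSum.mul_left _ ?_)
    refine hasSum_hurwitzZetaSeries ?_ (by positivity)
    have hm : (m : ℝ) + 1 ≤ r := by exact_mod_cast Finset.mem_range.1 hm
    simp only [Complex.sub_re, Complex.natCast_re]
    linarith)
  rw [hsum.tsum_eq, ← Finset.mul_sum, Finset.sum_comm]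
  congr 1
  refine Finset.sum_congr rfl fun m _ => ?_
  rw [Finset.range_eq_Ico,
    Finset.sum_Ico_add' (fun v => γ m v * hurwitzZetaSeries (s - m) (((v : ℕ) / D : ℝ) : ℂ)) 0 D 1]
  push_cast
  rfl
end

section
/- For every n ≥ 0, p_a(n) = (1/(r−1)!) ∑_{(j_1,…,j_r): 0 ≤ j_i ≤ D/a_i − 1 for all i, a_1j_1+⋯+a_rj_r ≡ n (mod D)} ∏_{ℓ=1}^{r−1} ( (n − a_1j_1 − ⋯ − a_rj_r)/D + ℓ ), where (n − a_1j_1 − ⋯ − a_rj_r)/D is an integer for each tuple in the sum. -/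
/-- Stars and bars: the number of functions `ι → ℕ` with sum `k`. -/
theorem natCard_sum_eq_multichoose (ι : Type*) [Fintype ι] [DecidableEq ι] (k : ℕ) :
    Nat.card {q : ι → ℕ // ∑ i, q i = k} = (Fintype.card ι).multichoose k := by
  rw [← Nat.card_congr (Sym.equivNatSumOfFintype ι k), Nat.card_eq_fintype_card,
    Sym.card_sym_eq_multichoose]

theorem finite_sum_eq (ι : Type*) [Fintype ι] (k : ℕ) :
    Finite {q : ι → ℕ // ∑ i, q i = k} := by
  classical exact Finite.of_equiv _ (Sym.equivNatSumOfFintype ι k)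

/-- The number of ways to write `k` as an ordered sum of `m + 1` natural numbers, as a product. -/
theorem multichoose_succ_eq_prod_div_factorial (m k : ℕ) :
    ((m + 1).multichoose k : ℚ) =
      1 / (m.factorial : ℚ) * ∏ l ∈ Finset.range m, ((k : ℚ) + ((l : ℚ) + 1)) := by
  have h : m.factorial * (m + 1).multichoose k = ∏ l ∈ Finset.range m, (k + (l + 1)) := by
    have hsymm : (m + k).choose k = (k + m).choose m := by
      rw [Nat.add_comm m k, Nat.choose_symm_add]
    rw [Nat.multichoose_eq, Nat.add_right_comm, Nat.add_sub_cancel, hsymm,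
      ← Nat.ascFactorial_eq_factorial_mul_choose, Nat.ascFactorial_eq_prod_range]
    exact Finset.prod_congr rfl fun l _ => by ring
  have hm : (m.factorial : ℚ) ≠ 0 := by exact_mod_cast m.factorial_ne_zero
  rw [one_div, eq_inv_mul_iff_mul_eq₀ hm]
  exact_mod_cast h

/-- Coordinatewise division with remainder, `x i = j i + d i * q i`. -/
def piDivModEquiv {ι : Type*} (d : ι → ℕ) (hd : ∀ i, 0 < d i) :
    (ι → ℕ) ≃ (∀ i, Fin (d i)) × (ι → ℕ) where
  toFun x := (fun i => ⟨x i % d i, Nat.mod_lt _ (hd i)⟩, fun i => x i / d i)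
  invFun p i := p.1 i + d i * p.2 i
  left_inv x := funext fun i => Nat.mod_add_div _ _
  right_inv p := by
    refine Prod.ext (funext fun i => Fin.ext ?_) (funext fun i => ?_)
    · simp [Nat.mod_eq_of_lt (p.1 i).isLt]
    · simp [Nat.add_mul_div_left _ _ (hd i), Nat.div_eq_of_lt (p.1 i).isLt]

/-- A restricted partition amounts to a tuple of remainders modulo the `D / a i` together with a
tuple of quotients. -/
def restrictedPartitionEquiv {r : ℕ} {a : Fin r → ℕ} {D : ℕ} (hD : 0 < D)
    (hdvd : ∀ i, a i ∣ D) (n : ℕ) :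
    {x : Fin r → ℕ // ∑ i, a i * x i = n} ≃
      Σ j : ∀ i, Fin (D / a i),
        {q : Fin r → ℕ // ∑ i, a i * (j i : ℕ) + D * ∑ i, q i = n} :=
  have hd : ∀ i, 0 < D / a i := fun i => Nat.div_pos (Nat.le_of_dvd hD (hdvd i))
    (Nat.pos_of_dvd_of_pos (hdvd i) hD)
  ((piDivModEquiv (fun i => D / a i) hd).symm.subtypeEquiv
    (p := fun p => ∑ i, a i * (p.1 i : ℕ) + D * ∑ i, p.2 i = n) (fun p => by
      have : ∑ i, a i * (p.1 i : ℕ) + D * ∑ i, p.2 i =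
          ∑ i, a i * ((p.1 i : ℕ) + D / a i * p.2 i) := by
        rw [Finset.mul_sum, ← Finset.sum_add_distrib]
        refine Finset.sum_congr rfl fun i _ => ?_
        rw [mul_add, ← mul_assoc, Nat.mul_div_cancel' (hdvd i)]
      rw [this]; rfl)).symm.trans
  (Equiv.subtypeProdEquivSigmaSubtype fun (j : ∀ i, Fin (D / a i)) (q : Fin r → ℕ) =>
    ∑ i, a i * (j i : ℕ) + D * ∑ i, q i = n)

theorem finite_add_mul_sum_eq {ι : Type*} [Fintype ι] {D : ℕ} (hD : 0 < D) (s n : ℕ) :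
    Finite {q : ι → ℕ // s + D * ∑ i, q i = n} := by
  have : Finite {q : ι → ℕ | ∑ i, q i = (n - s) / D} := finite_sum_eq ι _
  refine Finite.Set.subset {q : ι → ℕ | ∑ i, q i = (n - s) / D} ?_
  rintro q rfl
  simp [Nat.mul_div_cancel_left _ hD]

/-- The contribution of a single tuple of remainders, with `s` the value of `∑ a i * j i`. -/
theorem natCard_add_mul_sum_eq {m D s n : ℕ} (hD : 0 < D) (hs : s < (m + 1) * D) :
    (Nat.card {q : Fin (m + 1) → ℕ // s + D * ∑ i, q i = n} : ℚ) =
      if s % D = n % D then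
        1 / (m.factorial : ℚ) *
          ∏ l ∈ Finset.range m, (((n : ℚ) - (s : ℚ)) / (D : ℚ) + ((l : ℚ) + 1))
      else 0 := by
  have hD' : (D : ℚ) ≠ 0 := by exact_mod_cast hD.ne'
  split_ifs with h
  · rcases le_or_gt s n with hsn | hns
    · obtain ⟨k, hk⟩ := (Nat.modEq_iff_dvd' hsn).1 h
      obtain rfl : n = s + D * k := by omega
      have hset : Nat.card {q : Fin (m + 1) → ℕ // s + D * ∑ i, q i = s + D * k} =
          (m + 1).multichoose k := by
        simp only [Nat.add_left_cancel_iff, Nat.mul_right_inj hD.ne']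
        rw [natCard_sum_eq_multichoose, Fintype.card_fin]
      rw [hset, multichoose_succ_eq_prod_div_factorial]
      push_cast
      rw [add_sub_cancel_left, mul_div_cancel_left₀ _ hD']
    · have : IsEmpty {q : Fin (m + 1) → ℕ // s + D * ∑ i, q i = n} :=
        ⟨fun q => absurd q.2 (by omega)⟩
      obtain ⟨k, hk⟩ := (Nat.modEq_iff_dvd' hns.le).1 (Eq.symm h)
      obtain rfl : s = n + D * k := by omega
      have hk0 : k ≠ 0 := by rintro rfl; simp at hns
      have hkm : k < m + 1 := by
        by_contra! hc
        have := Nat.mul_le_mul_right D hc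
        rw [Nat.mul_comm k D] at this
        omega
      rw [Nat.card_of_isEmpty, Finset.prod_eq_zero (i := k - 1), mul_zero, Nat.cast_zero]
      · exact Finset.mem_range.2 (by omega)
      · rw [Nat.cast_sub (by omega)]
        push_cast
        field_simp
        ring
  · have : IsEmpty {q : Fin (m + 1) → ℕ // s + D * ∑ i, q i = n} :=
      ⟨fun q => h (by rw [← q.2, Nat.add_mul_mod_self_left])⟩
    rw [Nat.card_of_isEmpty, Nat.cast_zero]

/-- Corollary 1.10: `p_a(n) = (1/(r−1)!) ∑_{j : a·j ≡ n (mod D)}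
∏_{ℓ=1}^{r−1} ((n − a·j)/D + ℓ)`. -/
theorem restrictedPartition_product_formula
    (r : ℕ) (hr : 1 ≤ r) (a : Fin r → ℕ) (ha : ∀ i, 0 < a i)
    (D : ℕ) (hD : 0 < D) (hdvd : ∀ i, a i ∣ D)
    (n : ℕ) :
    (restrictedPartition r a n : ℚ) =
      1 / (Nat.factorial (r - 1) : ℚ) *
        ∑ j ∈ Finset.univ.filter
            (fun j : ∀ i : Fin r, Fin (D / a i) => (∑ i, a i * (j i : ℕ)) % D = n % D),
          ∏ l ∈ Finset.range (r - 1),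
            (((n : ℚ) - ((∑ i, a i * (j i : ℕ) : ℕ) : ℚ)) / (D : ℚ) + ((l : ℚ) + 1)) := by
  obtain ⟨m, rfl⟩ := Nat.exists_eq_add_of_le' hr
  have hfin : ∀ j : ∀ i, Fin (D / a i),
      Finite {q : Fin (m + 1) → ℕ // ∑ i, a i * (j i : ℕ) + D * ∑ i, q i = n} :=
    fun j => finite_add_mul_sum_eq hD _ n
  rw [restrictedPartition, Nat.card_congr (restrictedPartitionEquiv hD hdvd n), Nat.card_sigma,
    Nat.cast_sum, Nat.add_sub_cancel, Finset.mul_sum, Finset.sum_filter]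
  refine Finset.sum_congr rfl fun j _ => natCard_add_mul_sum_eq hD ?_
  calc ∑ i, a i * (j i : ℕ) < ∑ _i : Fin (m + 1), D :=
        Finset.sum_lt_sum_of_nonempty Finset.univ_nonempty fun i _ =>
          (Nat.mul_lt_mul_of_pos_left (j i).isLt (ha i)).trans_eq (Nat.mul_div_cancel' (hdvd i))
    _ = (m + 1) * D := by simp
end
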